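/- arXiv:2207.08197 — 7 statements merged into one kernel-verified Lean document; each statement's English description precedes it below -/
import Mathlib

section
/- Let V be a poset, W ⊆ V, and let S : V → P(W) be a multifunction that is increasing upward (i.e. v ≤ w in V implies S(v) ≤* S(w)). Then every maximal element of the set Sub S of subpoints of S is a maximal element of the set Fix S of fixed points of S. -/
/-- Let `V` be a poset, `W ⊆ V`, and `S : V → P(W)` increasing upward
(`v ≤ w` implies `S v ≤* S w`). Then every maximal element of `Sub S` (the subpoints,
`{v ∈ W : {v} ≤* S v}`) is a maximal element of `Fix S` (`{v ∈ W : v ∈ S v}`). -/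
theorem maximal_subpoint_is_maximal_fixedPoint
    {V : Type*} [PartialOrder V] (W : Set V) (S : V → Set V)
    (hSW : ∀ v, S v ⊆ W)
    (hinc : ∀ v w : V, v ≤ w → ∀ a ∈ S v, ∃ b ∈ S w, a ≤ b)
    (v' : V)
    (hsub : v' ∈ W ∧ ∃ b ∈ S v', v' ≤ b)
    (hmax : ∀ w : V, (w ∈ W ∧ ∃ b ∈ S w, w ≤ b) → v' ≤ w → v' = w) :
    (v' ∈ W ∧ v' ∈ S v') ∧
      ∀ w : V, (w ∈ W ∧ w ∈ S w) → v' ≤ w → v' = w := by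
  obtain ⟨hvW, b, hb, hvb⟩ := hsub
  have hv : v' = b := hmax b ⟨hSW v' hb, hinc v' b hvb b hb⟩ hvb
  exact ⟨⟨hvW, hv ▸ hb⟩, fun w hw hle => hmax w ⟨hw.1, w, hw.2, le_rfl⟩ hle⟩
end

section
/- Let V be a chain-complete poset, W ⊆ V, and let S : V → P(W) be increasing upward and such that every value S(v) is inductive in W. Then the set Sub S of subpoints of S is an inductive poset (i.e. every chain in Sub S has an upper bound in Sub S). -/
/-- Let `V` be a chain-complete poset, `W ⊆ V`, and let `S : V → P(W)` be
increasing upward such that every value `S v` is inductive in `W`. Then the set of subpoints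
`Sub S = {v ∈ W : {v} ≤* S v}` is an inductive poset: every chain in it has an upper bound
in it. -/
theorem subpoints_inductive
    {V : Type*} [PartialOrder V] (W : Set V) (S : V → Set V)
    (hSW : ∀ v, S v ⊆ W)
    (hcc : ∀ C : Set V, IsChain (· ≤ ·) C → ∃ c : V, IsLUB C c)
    (hinc : ∀ v w : V, v ≤ w → ∀ a ∈ S v, ∃ b ∈ S w, a ≤ b)
    (hind : ∀ v : V, ∀ C : Set V, C ⊆ W → IsChain (· ≤ ·) C →
      (∀ c ∈ C, ∃ d ∈ S v, c ≤ d) → ∃ d ∈ S v, ∀ c ∈ C, c ≤ d) :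
    ∀ C : Set V, C ⊆ {v | v ∈ W ∧ ∃ b ∈ S v, v ≤ b} → IsChain (· ≤ ·) C →
      ∃ u ∈ {v | v ∈ W ∧ ∃ b ∈ S v, v ≤ b}, ∀ c ∈ C, c ≤ u := by
  intro C hC hchain
  obtain ⟨s, hs⟩ := hcc C hchain
  obtain ⟨d, hd, hCd⟩ := hind s C (fun c hc => (hC hc).1) hchain fun c hc => by
    obtain ⟨b, hb, hcb⟩ := (hC hc).2
    obtain ⟨b', hb', hbb'⟩ := hinc c s (hs.1 hc) b hb
    exact ⟨b', hb', hcb.trans hbb'⟩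
  exact ⟨d, ⟨hSW s hd, hinc s d (hs.2 hCd) d hd⟩, hCd⟩
end

section
/- Let V be an ordered topological space (a poset with a topology in which all upper sets a^↑ = {c : a ≤ c} and lower sets b^↓ = {c : c ≤ b} are closed). If A ⊆ V is compact, closed and nonempty, then A is inductive in V: for every chain C ⊆ V with C ≤* A there exists a ∈ A with C ≤* {a}. -/
/-- Let `V` be an ordered topological space (all upper sets `a^↑` and lower
sets `b^↓` are closed). If `A ⊆ V` is compact, closed and nonempty, then `A` is inductive
in `V`: every chain `C ⊆ V` with `C ≤* A` satisfies `C ≤* {a}` for some `a ∈ A`. -/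
theorem compact_closed_nonempty_inductive
    {V : Type*} [PartialOrder V] [TopologicalSpace V]
    (hup : ∀ a : V, IsClosed {c : V | a ≤ c})
    (hdown : ∀ b : V, IsClosed {c : V | c ≤ b})
    (A : Set V) (hAcpt : IsCompact A) (hAcl : IsClosed A) (hAne : A.Nonempty) :
    ∀ C : Set V, IsChain (· ≤ ·) C → (∀ c ∈ C, ∃ a ∈ A, c ≤ a) →
      ∃ a ∈ A, ∀ c ∈ C, c ≤ a := by
  intro C hC hCA
  rcases C.eq_empty_or_nonempty with rfl | hCne
  · obtain ⟨a, ha⟩ := hAne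
    exact ⟨a, ha, fun c hc => hc.elim⟩
  have : Nonempty C := hCne.to_subtype
  obtain ⟨a, ha⟩ := IsCompact.nonempty_iInter_of_directed_nonempty_isCompact_isClosed
    (fun c : C => A ∩ {x | (c : V) ≤ x})
    (fun c d => by
      rcases hC.total c.2 d.2 with h | h
      · exact ⟨d, fun x hx => ⟨hx.1, h.trans hx.2⟩, subset_rfl⟩
      · exact ⟨c, subset_rfl, fun x hx => ⟨hx.1, h.trans hx.2⟩⟩)
    (fun c => hCA c c.2)
    (fun c => hAcpt.inter_right (hup c))
    (fun c => hAcl.inter (hup c))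
  rw [Set.mem_iInter] at ha
  exact ⟨a, (ha (Classical.arbitrary C)).1, fun c hc => (ha ⟨c, hc⟩).2⟩
end

section
/- Let V be an ordered topological space and let A ⊆ V be compact. If A has a smallest element, then A (with the induced order) is chain-complete: every chain C ⊆ A has a supremum in A. -/
/-- Let `V` be an ordered topological space and `A ⊆ V` compact with a
smallest element. Then `A` (with the induced order) is chain-complete: every chain `C ⊆ A`
has a supremum in `A` (a smallest upper bound among the elements of `A`). -/
theorem compact_with_least_chainComplete
    {V : Type*} [PartialOrder V] [TopologicalSpace V]
    (hup : ∀ a : V, IsClosed {c : V | a ≤ c})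
    (hdown : ∀ b : V, IsClosed {c : V | c ≤ b})
    (A : Set V) (hAcpt : IsCompact A)
    (m : V) (hm : m ∈ A) (hmin : ∀ a ∈ A, m ≤ a) :
    ∀ C : Set V, C ⊆ A → IsChain (· ≤ ·) C →
      ∃ s ∈ A, (∀ c ∈ C, c ≤ s) ∧ ∀ b ∈ A, (∀ c ∈ C, c ≤ b) → s ≤ b := by
  intro C hCA hC
  rcases C.eq_empty_or_nonempty with rfl | hne
  · exact ⟨m, hm, by simp, fun b hb _ => hmin b hb⟩
  have : Nonempty C := hne.to_subtype
  have hdir : Directed (· ≤ ·) (Subtype.val : C → V) :=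
    directedOn_iff_directed.1 hC.directedOn
  obtain ⟨s, hsA, hs⟩ := hAcpt.inter_iInter_nonempty
    (fun c : C => {x : V | c.1 ≤ x} ∩ ⋂ b ∈ upperBounds C, {x : V | x ≤ b})
    (fun c => (hup c.1).inter (isClosed_biInter fun b _ => hdown b)) (by
      intro u
      obtain ⟨d, hd⟩ := hdir.finset_le u
      refine ⟨d.1, hCA d.2, ?_⟩
      simp only [Set.mem_iInter]
      exact fun c hc => ⟨hd c hc, Set.mem_iInter₂.2 fun b hb => hb d.2⟩)
  rw [Set.mem_iInter] at hs
  obtain ⟨c₀, hc₀⟩ := hne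
  exact ⟨s, hsA, fun c hc => (hs ⟨c, hc⟩).1,
    fun b _ hb => Set.mem_iInter₂.1 (hs ⟨c₀, hc₀⟩).2 b fun c hc => hb c hc⟩
end

section
/- Let V be an upper semilattice and let S : V → P(V) be a multifunction all of whose values are directed upward, and which is permanent upward (i.e. a ≤ b implies S(a) ⊆ S(b)). Then Fix S is directed upward. -/
/-- Let `V` be an upper semilattice and `S : V → P(V)` a multifunction all of
whose values are directed upward and which is permanent upward (`a ≤ b → S a ⊆ S b`). Then
`Fix S` is directed upward. -/
theorem fixedPoints_directed
    {V : Type*} [SemilatticeSup V] (S : V → Set V)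
    (hdir : ∀ v : V, ∀ a ∈ S v, ∀ b ∈ S v, ∃ c ∈ S v, a ≤ c ∧ b ≤ c)
    (hperm : ∀ a b : V, a ≤ b → S a ⊆ S b) :
    ∀ a : V, a ∈ S a → ∀ b : V, b ∈ S b → ∃ c : V, c ∈ S c ∧ a ≤ c ∧ b ≤ c := by
  intro a ha b hb
  obtain ⟨c, hc, hac, hbc⟩ := hdir (a ⊔ b) a (hperm _ _ le_sup_left ha) b
    (hperm _ _ le_sup_right hb)
  exact ⟨c, hperm _ _ (sup_le hac hbc) hc, hac, hbc⟩
end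

section
/- Let V be a poset and W ⊆ V, each equipped with a topology making it an ordered topological space. Let D ⊆ V and let S̲ : D → P(D) and S : D → P(D ∩ W) be multifunctions such that: (i) D is an upper semilattice and compact in V; (ii) all values of S are compact in W and closed in W; (iii) S̲ is permanent upward, all values of S̲ are directed upward, and for all v ∈ D one has S(v) ⊆ S̲(v) and S̲(v) ≤* S(v); (iv) there is u̲ ∈ D with {u̲} ≤* S̲(u̲). Then S has a greatest fixed point u*, and u̲ ≤ u*. -/
theorem IsCompact.exists_isGreatest_of_directedOn {X : Type*} [PartialOrder X]
    [TopologicalSpace X] {s : Set X} (hs : IsCompact s) (hne : s.Nonempty)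
    (hdir : ∀ a ∈ s, ∀ b ∈ s, ∃ c ∈ s, a ≤ c ∧ b ≤ c)
    (hup : ∀ a : X, IsClosed {c : X | a ≤ c}) : ∃ m, IsGreatest s m := by
  classical
  have hbound : ∀ F : Finset s, ∃ c ∈ s, ∀ i ∈ F, (i : X) ≤ c := by
    intro F
    induction F using Finset.induction_on with
    | empty => exact hne.imp fun c hc => ⟨hc, by simp⟩
    | insert a F _ ih =>
      obtain ⟨c, hc, hcF⟩ := ih
      obtain ⟨d, hd, had, hcd⟩ := hdir a a.2 c hc
      refine ⟨d, hd, fun i hi => ?_⟩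
      rcases Finset.mem_insert.1 hi with rfl | hi
      · exact had
      · exact (hcF i hi).trans hcd
  obtain ⟨m, hm, hmub⟩ := hs.inter_iInter_nonempty (fun a : s => {c : X | (a : X) ≤ c})
    (fun a => hup a) fun F => by
      obtain ⟨c, hc, hcF⟩ := hbound F
      exact ⟨c, hc, Set.mem_iInter₂.2 hcF⟩
  exact ⟨m, hm, fun a ha => Set.mem_iInter.1 hmub ⟨a, ha⟩⟩

/-- In a compact upper semilattice every nonempty subset has a supremum. -/
theorem IsCompact.exists_sup_of_semilattice {X : Type*} [PartialOrder X]
    [TopologicalSpace X] {D A : Set X} (hD : IsCompact D)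
    (hup : ∀ a : X, IsClosed {c : X | a ≤ c}) (hdown : ∀ b : X, IsClosed {c : X | c ≤ b})
    (hsemi : ∀ a ∈ D, ∀ b ∈ D, ∃ c ∈ D, a ≤ c ∧ b ≤ c ∧ ∀ d ∈ D, a ≤ d → b ≤ d → c ≤ d)
    (hA : A.Nonempty) (hAD : A ⊆ D) :
    ∃ u ∈ D, (∀ a ∈ A, a ≤ u) ∧ ∀ d ∈ D, (∀ a ∈ A, a ≤ d) → u ≤ d := by
  set C : Set X := ⋂ d ∈ {d ∈ D | ∀ a ∈ A, a ≤ d}, {c : X | c ≤ d} with hC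
  have hmemC : ∀ c, c ∈ C ↔ ∀ d ∈ D, (∀ a ∈ A, a ≤ d) → c ≤ d := by
    intro c
    simp [hC]
  have hAC : A ⊆ D ∩ C := fun a ha => ⟨hAD ha, (hmemC a).2 fun _ _ hd => hd a ha⟩
  obtain ⟨u, hu, hub⟩ := (hD.inter_right
    (isClosed_biInter fun d _ => hdown d : IsClosed C)).exists_isGreatest_of_directedOn
    (hA.mono hAC)
    (fun a ha b hb => by
      obtain ⟨c, hc, hac, hbc, hmin⟩ := hsemi a ha.1 b hb.1
      exact ⟨c, ⟨hc, (hmemC c).2 fun d hd hdA =>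
        hmin d hd ((hmemC a).1 ha.2 d hd hdA) ((hmemC b).1 hb.2 d hd hdA)⟩, hac, hbc⟩)
    hup
  exact ⟨u, hu.1, fun a ha => hub (hAC ha), (hmemC u).1 hu.2⟩


/-- The abstract subpoint method: under conditions (i)–(iv) on the
suboperator `Sl` and the operator `S`, the operator `S` has a greatest fixed point `u*`
and `ubar ≤ u*`. -/
theorem greatest_fixedPoint_exists
    {V : Type*} [PartialOrder V] [TopologicalSpace V]
    (hupV : ∀ a : V, IsClosed {c : V | a ≤ c})
    (hdownV : ∀ b : V, IsClosed {c : V | c ≤ b})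
    (W : Set V) [TopologicalSpace W]
    (hupW : ∀ a : W, IsClosed {c : W | a ≤ c})
    (hdownW : ∀ b : W, IsClosed {c : W | c ≤ b})
    (D : Set V) (hDcpt : IsCompact D)
    -- (i) D is an upper semilattice (in the induced order)
    (hDsemi : ∀ a ∈ D, ∀ b ∈ D, ∃ c ∈ D, a ≤ c ∧ b ≤ c ∧ ∀ d ∈ D, a ≤ d → b ≤ d → c ≤ d)
    (Sl S : V → Set V)
    (hSlsub : ∀ v ∈ D, Sl v ⊆ D)
    (hSsub : ∀ v ∈ D, S v ⊆ D ∩ W)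
    -- (ii) all values of S are compact and closed in W
    (hScpt : ∀ v ∈ D, IsCompact (Subtype.val ⁻¹' S v : Set W))
    (hScl : ∀ v ∈ D, IsClosed (Subtype.val ⁻¹' S v : Set W))
    -- (iii) Sl is permanent upward, its values are directed upward, S(v) ⊆ Sl(v) ≤* S(v)
    (hSlperm : ∀ v ∈ D, ∀ w ∈ D, v ≤ w → Sl v ⊆ Sl w)
    (hSldir : ∀ v ∈ D, ∀ a ∈ Sl v, ∀ b ∈ Sl v, ∃ c ∈ Sl v, a ≤ c ∧ b ≤ c)
    (hSSl : ∀ v ∈ D, S v ⊆ Sl v)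
    (hSlS : ∀ v ∈ D, ∀ a ∈ Sl v, ∃ b ∈ S v, a ≤ b)
    -- (iv) there is ubar ∈ D with {ubar} ≤* Sl(ubar)
    (ubar : V) (hubar : ubar ∈ D) (hubarsub : ∃ b ∈ Sl ubar, ubar ≤ b) :
    ∃ u : V, (u ∈ D ∧ u ∈ S u) ∧ (∀ w : V, (w ∈ D ∧ w ∈ S w) → w ≤ u) ∧ ubar ≤ u := by
  have hgreatest : ∀ v ∈ D, (Sl v).Nonempty → ∃ g ∈ S v, ∀ a ∈ Sl v, a ≤ g := by
    rintro v hv ⟨a, ha⟩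
    obtain ⟨b, hb, -⟩ := hSlS v hv a ha
    obtain ⟨m, hm, hmub⟩ := (hScpt v hv).exists_isGreatest_of_directedOn
      ⟨⟨b, (hSsub v hv hb).2⟩, hb⟩
      (fun x hx y hy => by
        obtain ⟨c, hc, hxc, hyc⟩ := hSldir v hv x (hSSl v hv hx) y (hSSl v hv hy)
        obtain ⟨d, hd, hcd⟩ := hSlS v hv c hc
        exact ⟨⟨d, (hSsub v hv hd).2⟩, hd, hxc.trans hcd, hyc.trans hcd⟩)
      hupW
    refine ⟨m, hm, fun x hx => ?_⟩
    obtain ⟨y, hy, hxy⟩ := hSlS v hv x hx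
    have hym : (⟨y, (hSsub v hv hy).2⟩ : W) ≤ m := hmub hy
    exact hxy.trans hym
  -- The supremum of the subpoints is the greatest fixed point.
  obtain ⟨u, huD, hu, hmin⟩ := hDcpt.exists_sup_of_semilattice
    (A := {v | v ∈ D ∧ ∃ b ∈ Sl v, v ≤ b}) hupV hdownV hDsemi
    ⟨ubar, hubar, hubarsub⟩ (fun v hv => hv.1)
  have hubaru : ubar ≤ u := hu ubar ⟨hubar, hubarsub⟩
  obtain ⟨g, hg, hgub⟩ := hgreatest u huD
    (hubarsub.imp fun b hb => hSlperm ubar hubar u huD hubaru hb.1)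
  have hgD : g ∈ D := (hSsub u huD hg).1
  have hug : u ≤ g := hmin g hgD fun v hv => by
    obtain ⟨hvD, b, hb, hvb⟩ := hv
    exact hvb.trans (hgub b (hSlperm v hvD u huD (hu v ⟨hvD, b, hb, hvb⟩) hb))
  have hgu : g ≤ u := hu g ⟨hgD, g, hSlperm u huD g hgD hug (hSSl u huD hg), le_rfl⟩
  obtain rfl : u = g := le_antisymm hug hgu
  exact ⟨u, ⟨huD, hg⟩, fun w hw => hu w ⟨hw.1, w, hSSl w hw.1 hw.2, le_rfl⟩, hubaru⟩
end

section
/- Let W be a distributive lattice and let a, b, c ∈ Γ(W) satisfy a ≼ b, b ≼ c, and b ≼ b (i.e. b is submodular). Then a ≼ c. -/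
/-- Let `W` be a distributive lattice and `a, b, c ∈ Γ(W)` with `a ≼ b`,
`b ≼ c` and `b ≼ b` (`b` submodular). Then `a ≼ c`. -/
theorem preccurly_trans_of_submodular
    {W : Type*} [DistribLattice W] (a b c : W → WithTop ℝ)
    (ha : ∃ u, a u ≠ ⊤) (hb : ∃ u, b u ≠ ⊤) (hc : ∃ u, c u ≠ ⊤)
    (hab : ∀ u w : W, a (u ⊓ w) + b (u ⊔ w) ≤ a u + b w)
    (hbc : ∀ u w : W, b (u ⊓ w) + c (u ⊔ w) ≤ b u + c w)
    (hbb : ∀ u w : W, b (u ⊓ w) + b (u ⊔ w) ≤ b u + b w) :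
    ∀ u w : W, a (u ⊓ w) + c (u ⊔ w) ≤ a u + c w := by
  intro u w
  obtain ⟨v, hv⟩ := hb
  by_cases hau : a u = ⊤
  · simp [hau]
  by_cases hcw : c w = ⊤
  · simp [hcw]
  have huv : b (u ⊔ v) ≠ ⊤ := fun h => by
    have := hab u v
    simp [h, hau, hv] at this
  obtain ⟨m, hm⟩ : ∃ m, m = (u ⊔ v) ⊓ w := ⟨_, rfl⟩
  have hbm : b m ≠ ⊤ := fun h => by
    have := hbc (u ⊔ v) w
    simp [← hm, h, huv, hcw] at this
  have hinf : u ⊓ m = u ⊓ w := by rw [hm, ← inf_assoc, inf_sup_self]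
  have hmw : m ≤ w := hm ▸ inf_le_right
  have hle : u ⊓ w ≤ m := hinf ▸ inf_le_right
  have hmid : (u ⊔ m) ⊓ w = m := by
    rw [inf_sup_right, inf_eq_left.2 hmw, sup_eq_right.2 hle]
  have hsup : u ⊔ m ⊔ w = u ⊔ w := by rw [sup_assoc, sup_eq_right.2 hmw]
  have h₁ := hab u m
  have h₂ := hbc (u ⊔ m) w
  rw [hinf] at h₁
  rw [hmid, hsup] at h₂
  have hbum : b (u ⊔ m) ≠ ⊤ := fun h => by simp [h, hau, hbm] at h₁
  have hfin : b m + b (u ⊔ m) ≠ ⊤ := by simp [hbm, hbum]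
  refine (WithTop.add_le_add_iff_right hfin).1 ?_
  calc a (u ⊓ w) + c (u ⊔ w) + (b m + b (u ⊔ m))
      = (a (u ⊓ w) + b (u ⊔ m)) + (b m + c (u ⊔ w)) := by ac_rfl
    _ ≤ (a u + b m) + (b (u ⊔ m) + c w) := add_le_add h₁ h₂
    _ = a u + c w + (b m + b (u ⊔ m)) := by ac_rfl
end
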